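/- Let Y ⊆ X be simplicial complexes with a set of bad simplices in X − Y satisfying conditions (1) and (2) of the link argument. If Y is n-connected and for every bad simplex σ the complex G_σ is (n − dim σ − 1)-connected, then X is n-connected. -/

import Mathlib

open scoped BigOperators

structure ASC (V : Type) where
  faces : Set (Finset V)
  nonempty_of_mem : ∀ ⦃s⦄, s ∈ faces → s.Nonempty
  down_closed : ∀ ⦃s t : Finset V⦄, s ∈ faces → t ⊆ s → t.Nonempty → t ∈ faces

namespace ASC

variable {V W : Type} [DecidableEq V] [DecidableEq W]

/-- The geometric realization of an abstract simplicial complex, as a subset of `V → ℝ`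
(barycentric coordinates, with the product topology on the subtype). -/
def space (K : ASC V) : Set (V → ℝ) :=
  {x | (∀ v, 0 ≤ x v) ∧ ∃ s ∈ K.faces, (∀ v, v ∉ s → x v = 0) ∧ ∑ v ∈ s, x v = 1}

/-- A vertex map is simplicial if it sends faces to faces. -/
def IsSimplicial (K : ASC V) (L : ASC W) (φ : V → W) : Prop :=
  ∀ s ∈ K.faces, s.image φ ∈ L.faces

/-- The map induced on geometric realizations by a vertex map. -/
noncomputable def push (φ : V → W) (x : V → ℝ) : W → ℝ :=
  fun w => ∑ᶠ v ∈ φ ⁻¹' {w}, x v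

/-- The link of a simplex. -/
def link (K : ASC V) (σ : Finset V) : ASC V where
  faces := {t | t ∈ K.faces ∧ Disjoint σ t ∧ σ ∪ t ∈ K.faces}
  nonempty_of_mem := fun _ ht => K.nonempty_of_mem ht.1
  down_closed := by
    rintro t u ⟨h1, h2, h3⟩ hsub hne
    exact ⟨K.down_closed h1 hsub hne, h2.mono_right hsub,
      K.down_closed h3 (Finset.union_subset_union_right hsub)
        ⟨hne.choose, Finset.mem_union_right _ hne.choose_spec⟩⟩

end ASC

/-- `n`-connectedness of a space (`n` an integer): nonempty when `n ≥ -1`, and all homotopy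
groups in dimensions `≤ n` vanish, at every basepoint. -/
def IsConn (X : Type) [TopologicalSpace X] (n : ℤ) : Prop :=
  (-1 ≤ n → Nonempty X) ∧
    ∀ i : ℕ, (i : ℤ) ≤ n → ∀ x : X, Subsingleton (HomotopyGroup (Fin i) X x)

/-- The subcomplex `G_σ` of the link of a bad simplex `σ`, consisting of the simplices `τ`
that are good for `σ`: every bad face of `τ ∗ σ` is contained in `σ`. -/
def goodFor {V : Type} [DecidableEq V] (K : ASC V) (Bad : Set (Finset V)) (σ : Finset V) :
    ASC V where
  faces := {t | t ∈ (K.link σ).faces ∧ ∀ u, u ⊆ t ∪ σ → u.Nonempty → u ∈ Bad → u ⊆ σ}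
  nonempty_of_mem := fun _ h => (K.link σ).nonempty_of_mem h.1
  down_closed := by
    rintro t u ⟨ht1, ht2⟩ hsub hne
    exact ⟨(K.link σ).down_closed ht1 hsub hne,
      fun w hw hwne hwb => ht2 w (hw.trans (Finset.union_subset_union_left hsub)) hwne hwb⟩

open Set Metric in
/-- The map `f`, restricted to the unit sphere of `ι → ℝ` for the sup norm (the boundary of a
cube), extends to a continuous map from the unit ball to `S`. -/
def HasFilling {ι E : Type*} [Fintype ι] [TopologicalSpace E] (S : Set E) (f : (ι → ℝ) → E) :
    Prop :=
  ∃ g : (ι → ℝ) → E, ContinuousOn g (closedBall 0 1) ∧ MapsTo g (closedBall 0 1) S ∧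
    EqOn g f (sphere 0 1)

open Set Metric in
/-- Extension form of `n`-connectedness: spheres of dimension at most `n` in `S` bound balls. -/
def ExtConn {E : Type*} [TopologicalSpace E] (S : Set E) (n : ℤ) : Prop :=
  ∀ (ι : Type) [Fintype ι], (Fintype.card ι : ℤ) ≤ n + 1 → ∀ f : (ι → ℝ) → E,
    ContinuousOn f (sphere 0 1) → MapsTo f (sphere 0 1) S → HasFilling S f

section Filling

open Set Metric

variable {ι κ E : Type*} [Fintype ι] [Fintype κ] [TopologicalSpace E] {S : Set E}

lemma mem_unitSphere_pi {x : ι → ℝ} :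
    x ∈ sphere (0 : ι → ℝ) 1 ↔ (∀ j, |x j| ≤ 1) ∧ ∃ j, |x j| = 1 := by
  have hle : ‖x‖ ≤ 1 ↔ ∀ j, |x j| ≤ 1 := by
    simp [pi_norm_le_iff_of_nonneg zero_le_one]
  have hlt : ‖x‖ < 1 ↔ ∀ j, |x j| < 1 := by
    simp [pi_norm_lt_iff zero_lt_one]
  rw [mem_sphere_zero_iff_norm]
  constructor
  · intro h
    have h1 := hle.1 h.le
    refine ⟨h1, ?_⟩
    by_contra! hne
    exact (hlt.2 fun j => lt_of_le_of_ne (h1 j) (hne j)).ne h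
  · rintro ⟨h1, j, hj⟩
    exact le_antisymm (hle.2 h1) (not_lt.1 fun h => (hlt.1 h j).ne hj)

lemma mem_unitBall_pi {x : ι → ℝ} : x ∈ closedBall (0 : ι → ℝ) 1 ↔ ∀ j, |x j| ≤ 1 := by
  simp [pi_norm_le_iff_of_nonneg zero_le_one]

lemma HasFilling.of_homotopy (H : ℝ → (ι → ℝ) → E)
    (hc : ContinuousOn (fun p : ℝ × (ι → ℝ) => H p.1 p.2) (Icc 0 1 ×ˢ sphere 0 1))
    (hm : ∀ t ∈ Icc (0 : ℝ) 1, MapsTo (H t) (sphere 0 1) S) (h1 : HasFilling S (H 1)) :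
    HasFilling S (H 0) := by
  obtain ⟨g, gc, gm, ge⟩ := h1
  let F : (ι → ℝ) → E := fun x =>
    if ‖x‖ ≤ 1 / 2 then g ((2 : ℝ) • x) else H (2 - 2 * ‖x‖) (‖x‖⁻¹ • x)
  have hg : ∀ x : ι → ℝ, ‖x‖ ≤ 1 / 2 → (2 : ℝ) • x ∈ closedBall (0 : ι → ℝ) 1 := by
    intro x hx
    rw [mem_closedBall_zero_iff, norm_smul, Real.norm_ofNat]
    linarith
  have hH : ∀ x : ι → ℝ, 1 / 2 ≤ ‖x‖ → ‖x‖ ≤ 1 →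
      (2 - 2 * ‖x‖, ‖x‖⁻¹ • x) ∈ Icc (0 : ℝ) 1 ×ˢ sphere (0 : ι → ℝ) 1 := by
    intro x hx hx'
    refine ⟨⟨by dsimp; linarith, by dsimp; linarith⟩, ?_⟩
    rw [mem_sphere_zero_iff_norm, norm_smul, norm_inv, norm_norm]
    exact inv_mul_cancel₀ (by linarith)
  have hhalf : ∀ x : ι → ℝ, 1 / 2 = ‖x‖ → g ((2 : ℝ) • x) = H (2 - 2 * ‖x‖) (‖x‖⁻¹ • x) := by
    intro x hx
    have h2 : (2 : ℝ) • x ∈ sphere (0 : ι → ℝ) 1 := by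
      rw [mem_sphere_zero_iff_norm, norm_smul, ← hx]; norm_num
    rw [ge h2, ← hx]
    norm_num
  refine ⟨F, ?_, ?_, ?_⟩
  · have e : closedBall (0 : ι → ℝ) 1 = {x | ‖x‖ ≤ 1 / 2} ∪ {x | 1 / 2 ≤ ‖x‖ ∧ ‖x‖ ≤ 1} := by
      ext x
      simp only [mem_closedBall_zero_iff, mem_union, mem_ofPred_eq]
      constructor
      · intro h
        rcases le_total ‖x‖ (1 / 2) with h' | h'
        · exact Or.inl h'
        · exact Or.inr ⟨h', h⟩
      · rintro (h | h)
        · linarith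
        · exact h.2
    rw [e]
    refine ContinuousOn.union_of_isClosed ?_ ?_
      (isClosed_le continuous_norm continuous_const)
      ((isClosed_le continuous_const continuous_norm).inter
        (isClosed_le continuous_norm continuous_const))
    · refine ContinuousOn.congr (f := fun x => g ((2 : ℝ) • x)) ?_ ?_
      · exact gc.comp (by fun_prop) fun x hx => hg x hx
      · intro x hx
        exact if_pos hx
    · refine ContinuousOn.congr (f := fun x => H (2 - 2 * ‖x‖) (‖x‖⁻¹ • x)) ?_ ?_
      · refine hc.comp (f := fun x : ι → ℝ => (2 - 2 * ‖x‖, ‖x‖⁻¹ • x)) ?_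
          fun x hx => hH x hx.1 hx.2
        have hi : ContinuousOn (fun x : ι → ℝ => ‖x‖⁻¹) {x | 1 / 2 ≤ ‖x‖ ∧ ‖x‖ ≤ 1} := by
          refine continuous_norm.continuousOn.inv₀ fun x hx => ?_
          have := hx.1
          intro h0
          rw [h0] at this
          norm_num at this
        exact ContinuousOn.prodMk (by fun_prop) (hi.smul continuousOn_id)
      · intro x hx
        by_cases h : ‖x‖ ≤ 1 / 2
        · exact (if_pos h).trans (hhalf x (le_antisymm hx.1 h))
        · exact if_neg h
  · intro x hx
    rw [mem_closedBall_zero_iff] at hx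
    by_cases h : ‖x‖ ≤ 1 / 2
    · simp only [F, if_pos h]
      exact gm (hg x h)
    · simp only [F, if_neg h]
      have := hH x (le_of_not_ge h) hx
      exact hm _ this.1 this.2
  · intro x hx
    rw [mem_sphere_zero_iff_norm] at hx
    simp only [F, hx]
    norm_num

/-- A filling on a sphere of the same dimension transfers along a pair of maps. -/
lemma HasFilling.exists_extension {D : Type*} [TopologicalSpace D] {C B : Set D}
    (φ : (κ → ℝ) → D) (ψ : D → κ → ℝ) (hφ : Continuous φ) (hψ : Continuous ψ)
    (φB : MapsTo φ (sphere 0 1) B) (ψC : MapsTo ψ C (closedBall 0 1))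
    (ψB : MapsTo ψ B (sphere 0 1)) (hφψ : ∀ x ∈ B, φ (ψ x) = x)
    (hS : ∀ f : (κ → ℝ) → E, ContinuousOn f (sphere 0 1) → MapsTo f (sphere 0 1) S →
      HasFilling S f)
    (f : D → E) (fc : ContinuousOn f B) (fm : MapsTo f B S) :
    ∃ g, ContinuousOn g C ∧ MapsTo g C S ∧ EqOn g f B := by
  obtain ⟨g, gc, gm, ge⟩ := hS (f ∘ φ) (fc.comp hφ.continuousOn φB) (fm.comp φB)
  refine ⟨g ∘ ψ, gc.comp hψ.continuousOn ψC, gm.comp ψC, ?_⟩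
  intro x hx
  simp [ge (ψB hx), hφψ x hx]

lemma ExtConn.extend_box (n : ℤ) (hS : ExtConn S n) {ι : Type} [Fintype ι] (lo hi : ι → ℝ)
    (hd : (Nat.card {j // lo j < hi j} : ℤ) ≤ n + 1) (f : (ι → ℝ) → E)
    (fc : ContinuousOn f {x ∈ Icc lo hi | ∃ j, lo j < hi j ∧ (x j = lo j ∨ x j = hi j)})
    (fm : MapsTo f {x ∈ Icc lo hi | ∃ j, lo j < hi j ∧ (x j = lo j ∨ x j = hi j)} S)
    (hle : lo ≤ hi) :
    ∃ g, ContinuousOn g (Icc lo hi) ∧ MapsTo g (Icc lo hi) S ∧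
      EqOn g f {x ∈ Icc lo hi | ∃ j, lo j < hi j ∧ (x j = lo j ∨ x j = hi j)} := by
  classical
  have hd' : (Fintype.card {j // lo j < hi j} : ℤ) ≤ n + 1 := by
    rwa [← Nat.card_eq_fintype_card]
  refine HasFilling.exists_extension (κ := {j // lo j < hi j})
    (fun y j => if h : lo j < hi j then (lo j + hi j) / 2 + y ⟨j, h⟩ * ((hi j - lo j) / 2)
      else lo j)
    (fun x j => (2 * x j - lo j - hi j) / (hi j - lo j)) ?_ (by fun_prop) ?_ ?_ ?_ ?_
    (hS _ hd') f fc fm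
  · refine continuous_pi fun j => ?_
    by_cases h : lo j < hi j
    · simp only [h, dif_pos]; fun_prop
    · simp only [h, dif_neg, not_false_eq_true]; fun_prop
  · intro y hy
    obtain ⟨h1, ⟨j, hj⟩, hj1⟩ := mem_unitSphere_pi.1 hy
    refine ⟨⟨fun i => ?_, fun i => ?_⟩, j, hj, ?_⟩
    · by_cases h : lo i < hi i
      · have := abs_le.1 (h1 ⟨i, h⟩)
        simp only [h, dif_pos]; nlinarith
      · simp [h]
    · by_cases h : lo i < hi i
      · have := abs_le.1 (h1 ⟨i, h⟩)
        simp only [h, dif_pos]; nlinarith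
      · simp only [h, dif_neg, not_false_eq_true]; exact hle i
    · simp only [hj, dif_pos]
      rcases eq_or_eq_neg_of_abs_eq hj1 with h | h <;> rw [h]
      · right; ring
      · left; ring
  · intro x hx
    rw [mem_unitBall_pi]
    rintro ⟨j, hj⟩
    have h1 := hx.1 j
    have h2 := hx.2 j
    have : 0 < hi j - lo j := sub_pos.2 hj
    rw [abs_le, le_div_iff₀ this, div_le_iff₀ this]
    constructor <;> linarith
  · rintro x ⟨hx, i, hi', hxi⟩
    rw [mem_unitSphere_pi]
    constructor
    · rintro ⟨j, hj⟩
      have h1 := hx.1 j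
      have h2 := hx.2 j
      have : 0 < hi j - lo j := sub_pos.2 hj
      rw [abs_le, le_div_iff₀ this, div_le_iff₀ this]
      constructor <;> linarith
    · refine ⟨⟨i, hi'⟩, ?_⟩
      have : 0 < hi i - lo i := sub_pos.2 hi'
      dsimp only
      rcases hxi with h | h <;> rw [h]
      · rw [show 2 * lo i - lo i - hi i = -(hi i - lo i) by ring, neg_div, div_self this.ne']
        simp
      · rw [show 2 * hi i - lo i - hi i = hi i - lo i by ring, div_self this.ne']
        simp
  · rintro x ⟨hx, -⟩
    ext j
    by_cases h : lo j < hi j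
    · have : hi j - lo j ≠ 0 := (sub_pos.2 h).ne'
      simp only [h, dif_pos]
      field_simp
      ring
    · simp only [h, dif_neg, not_false_eq_true]
      have := hx.1 j
      have := hx.2 j
      linarith

/-- Extension over a finite family of cells, attached in order of dimension, where the cell `m`
is required to map to `Φ m`. -/
lemma exists_extension_cells {D M : Type*} [TopologicalSpace D] [Finite M]
    (cell bd : M → Set D) (Φ : M → Set E) (dim : M → ℕ) (Z : Set D) (hZ : IsClosed Z)
    (f : D → E) (fc : ContinuousOn f Z) (hcl : ∀ m, IsClosed (cell m))
    (hbd : ∀ m, bd m ⊆ cell m)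
    (hcover : ∀ m, ∀ x ∈ bd m, x ∈ Z ∨ ∃ m', dim m' < dim m ∧ x ∈ cell m' ∧ Φ m' ⊆ Φ m)
    (hZm : ∀ m, cell m ∩ Z ⊆ bd m)
    (hmm : ∀ m m', m ≠ m' → dim m' ≤ dim m → cell m ∩ cell m' ⊆ bd m)
    (hf : ∀ m, MapsTo f (cell m ∩ Z) (Φ m))
    (hext : ∀ m (g : D → E), ContinuousOn g (bd m) → MapsTo g (bd m) (Φ m) →
      ∃ g', ContinuousOn g' (cell m) ∧ MapsTo g' (cell m) (Φ m) ∧ EqOn g' g (bd m)) :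
    ∃ g, ContinuousOn g (Z ∪ ⋃ m, cell m) ∧ EqOn g f Z ∧ ∀ m, MapsTo g (cell m) (Φ m) := by
  classical
  have key : ∀ T : Finset M, (∀ m ∈ T, ∀ m', dim m' < dim m → m' ∈ T) →
      ∃ g, ContinuousOn g (Z ∪ ⋃ m ∈ T, cell m) ∧ EqOn g f Z ∧
        ∀ m ∈ T, MapsTo g (cell m) (Φ m) := by
    intro T
    induction T using Finset.induction_on_max_value dim with
    | empty =>
      intro _
      exact ⟨f, by simpa using fc, fun _ _ => rfl, by simp⟩
    | insert a T haT hmax ih =>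
      intro hT
      obtain ⟨g, gc, ge, gm⟩ := ih (by
        intro m hm m' hlt
        have := hT m (Finset.mem_insert_of_mem hm) m' hlt
        rcases Finset.mem_insert.1 this with rfl | h
        · exact absurd (hmax m hm) (by omega)
        · exact h)
      have hsub : bd a ⊆ Z ∪ ⋃ m ∈ T, cell m := by
        intro x hx
        rcases hcover a x hx with h | ⟨m', hlt, hx', -⟩
        · exact Or.inl h
        · refine Or.inr (mem_iUnion₂.2 ⟨m', ?_, hx'⟩)
          exact (Finset.mem_insert.1 (hT a (Finset.mem_insert_self _ _) m' hlt)).resolve_left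
            (by rintro rfl; exact lt_irrefl _ hlt)
      have hmaps : MapsTo g (bd a) (Φ a) := by
        intro x hx
        rcases hcover a x hx with h | ⟨m', hlt, hx', hΦ⟩
        · rw [ge h]; exact hf a ⟨hbd a hx, h⟩
        · refine hΦ (gm m' ?_ hx')
          exact (Finset.mem_insert.1 (hT a (Finset.mem_insert_self _ _) m' hlt)).resolve_left
            (by rintro rfl; exact lt_irrefl _ hlt)
      obtain ⟨g', gc', gm', ge'⟩ := hext a g (gc.mono hsub) hmaps
      have hW : (Z ∪ ⋃ m ∈ T, cell m) ∩ cell a ⊆ bd a := by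
        rintro x ⟨h | h, hxa⟩
        · exact hZm a ⟨hxa, h⟩
        · obtain ⟨m, hm, hxm⟩ := mem_iUnion₂.1 h
          exact hmm a m (by rintro rfl; exact haT hm) (hmax m hm) ⟨hxa, hxm⟩
      let G : D → E := fun x => if x ∈ cell a then g' x else g x
      have hGa : EqOn G g' (cell a) := fun x hx => if_pos hx
      have hGW : EqOn G g (Z ∪ ⋃ m ∈ T, cell m) := by
        intro x hx
        by_cases h : x ∈ cell a
        · rw [hGa h, ge' (hW ⟨hx, h⟩)]
        · exact if_neg h
      refine ⟨G, ?_, ?_, ?_⟩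
      · rw [Finset.set_biUnion_insert, ← union_assoc, union_right_comm]
        exact (gc.congr hGW).union_of_isClosed (gc'.congr hGa)
          (hZ.union (T.finite_toSet.isClosed_biUnion fun m _ => hcl m)) (hcl a)
      · intro x hx
        rw [hGW (Or.inl hx), ge hx]
      · intro m hm x hx
        rcases Finset.mem_insert.1 hm with rfl | h
        · rw [hGa hx]; exact gm' hx
        · rw [hGW (Or.inr (mem_iUnion₂.2 ⟨m, h, hx⟩))]; exact gm m h hx
  have := Fintype.ofFinite M
  obtain ⟨g, gc, ge, gm⟩ := key Finset.univ (by simp)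
  exact ⟨g, by simpa using gc, ge, fun m => gm m (Finset.mem_univ _)⟩

end Filling

section Grid

open Set Metric

/-- The `a`-th point of the subdivision of `[-1, 1]` into `N` equal intervals. -/
noncomputable def gridPt (N a : ℕ) : ℝ := -1 + 2 * a / N

lemma gridPt_strictMono {N : ℕ} (hN : 0 < N) : StrictMono (gridPt N) := by
  intro a b h
  have hN' : (0 : ℝ) < N := by exact_mod_cast hN
  have : (a : ℝ) < b := by exact_mod_cast h
  unfold gridPt
  gcongr

lemma gridPt_zero (N : ℕ) : gridPt N 0 = -1 := by simp [gridPt]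

lemma gridPt_self {N : ℕ} (hN : 0 < N) : gridPt N N = 1 := by
  have hN' : (N : ℝ) ≠ 0 := by exact_mod_cast hN.ne'
  unfold gridPt
  field_simp
  norm_num

variable {ι : Type*} {N : ℕ}

/-- Lower corner of a cell of the cubical grid. The cells not contained in the boundary of the
cube `[-1, 1]^ι` are indexed by `ι → Fin (2 * N - 1)`; the even coordinates are the directions in
which the cell is nondegenerate. -/
noncomputable def gridLo (m : ι → Fin (2 * N - 1)) (j : ι) : ℝ := gridPt N ((m j + 1) / 2)

/-- Upper corner of a cell of the cubical grid. -/
noncomputable def gridHi (m : ι → Fin (2 * N - 1)) (j : ι) : ℝ := gridPt N (m j / 2 + 1)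

lemma gridLo_lt_gridHi (hN : 0 < N) (m : ι → Fin (2 * N - 1)) (j : ι) :
    gridLo m j < gridHi m j ↔ (m j : ℕ) % 2 = 0 := by
  unfold gridLo gridHi
  rw [(gridPt_strictMono hN).lt_iff_lt]
  omega

lemma gridLo_le_gridHi (hN : 0 < N) (m : ι → Fin (2 * N - 1)) : gridLo m ≤ gridHi m := by
  intro j
  exact (gridPt_strictMono hN).monotone (by omega)

variable [Fintype ι]

/-- The dimension of a cell of the cubical grid. -/
def gridDim (m : ι → Fin (2 * N - 1)) : ℕ := (Finset.univ.filter fun j => (m j : ℕ) % 2 = 0).card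

/-- The relative boundary of a cell of the cubical grid. -/
def gridBd (m : ι → Fin (2 * N - 1)) : Set (ι → ℝ) :=
  {x ∈ Icc (gridLo m) (gridHi m) |
    ∃ j, gridLo m j < gridHi m j ∧ (x j = gridLo m j ∨ x j = gridHi m j)}

lemma card_gridDim (hN : 0 < N) (m : ι → Fin (2 * N - 1)) :
    Nat.card {j // gridLo m j < gridHi m j} = gridDim m := by
  simp only [gridLo_lt_gridHi hN, gridDim, Nat.card_eq_fintype_card, Fintype.card_subtype]

lemma gridCell_subset_ball (hN : 0 < N) (m : ι → Fin (2 * N - 1)) :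
    Icc (gridLo m) (gridHi m) ⊆ closedBall (0 : ι → ℝ) 1 := by
  intro x hx
  rw [mem_unitBall_pi]
  intro j
  have h1 : gridPt N 0 ≤ gridLo m j := (gridPt_strictMono hN).monotone (Nat.zero_le _)
  have h2 : gridHi m j ≤ gridPt N N := (gridPt_strictMono hN).monotone (by have := (m j).2; omega)
  rw [gridPt_zero] at h1
  rw [gridPt_self hN] at h2
  exact abs_le.2 ⟨h1.trans (hx.1 j), (hx.2 j).trans h2⟩

lemma ball_subset_gridCells (hN : 0 < N) :
    closedBall (0 : ι → ℝ) 1 ⊆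
      sphere 0 1 ∪ ⋃ m : ι → Fin (2 * N - 1), Icc (gridLo m) (gridHi m) := by
  intro x hx
  by_cases hs : x ∈ sphere (0 : ι → ℝ) 1
  · exact Or.inl hs
  right
  rw [mem_unitBall_pi] at hx
  have hx1 : ∀ j, |x j| < 1 := fun j =>
    lt_of_le_of_ne (hx j) fun h => hs (mem_unitSphere_pi.2 ⟨hx, j, h⟩)
  have hN' : (0 : ℝ) < N := by exact_mod_cast hN
  have hfl : ∀ j, ⌊N * (x j + 1) / 2⌋₊ < N := by
    intro j
    have := abs_lt.1 (hx1 j)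
    rw [Nat.floor_lt (by have : 0 ≤ x j + 1 := by linarith
                         positivity)]
    nlinarith
  refine mem_iUnion.2 ⟨fun j => ⟨2 * ⌊N * (x j + 1) / 2⌋₊, by have := hfl j; omega⟩, ?_, ?_⟩
  · intro j
    have := abs_lt.1 (hx1 j)
    have h := Nat.floor_le (a := N * (x j + 1) / 2) (by
      have : 0 ≤ x j + 1 := by linarith
      positivity)
    simp only [gridLo, gridPt]
    rw [show (2 * ⌊N * (x j + 1) / 2⌋₊ + 1) / 2 = ⌊N * (x j + 1) / 2⌋₊ by omega,
      ← le_sub_iff_add_le', div_le_iff₀ hN']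
    linarith
  · intro j
    have h := Nat.lt_floor_add_one (N * (x j + 1) / 2)
    simp only [gridHi, gridPt]
    rw [show 2 * ⌊N * (x j + 1) / 2⌋₊ / 2 = ⌊N * (x j + 1) / 2⌋₊ by omega,
      ← sub_le_iff_le_add', le_div_iff₀ hN']
    push_cast
    linarith

lemma dist_lt_of_mem_gridCell (hN : 0 < N) {δ : ℝ} (hδ : 2 / N < δ) (m : ι → Fin (2 * N - 1))
    {x y : ι → ℝ} (hx : x ∈ Icc (gridLo m) (gridHi m)) (hy : y ∈ Icc (gridLo m) (gridHi m)) :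
    dist x y < δ := by
  have hN' : (0 : ℝ) < N := by exact_mod_cast hN
  refine lt_of_le_of_lt ((dist_pi_le_iff (by positivity)).2 fun j => ?_) hδ
  have h1 : gridHi m j ≤ gridLo m j + 2 / N := by
    have : ((m j / 2 + 1 : ℕ) : ℝ) ≤ (((m j + 1) / 2 : ℕ) : ℝ) + 1 := by
      exact_mod_cast (by omega : (m j : ℕ) / 2 + 1 ≤ (m j + 1) / 2 + 1)
    simp only [gridHi, gridLo, gridPt]
    rw [add_assoc, ← add_div]
    gcongr
    linarith
  have := hx.1 j
  have := hx.2 j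
  have := hy.1 j
  have := hy.2 j
  rw [Real.dist_eq, abs_le]
  constructor <;> linarith

lemma gridBd_cover (hN : 0 < N) (m : ι → Fin (2 * N - 1)) {x : ι → ℝ} (hx : x ∈ gridBd m) :
    x ∈ sphere (0 : ι → ℝ) 1 ∨ ∃ m' : ι → Fin (2 * N - 1), gridDim m' < gridDim m ∧
      x ∈ Icc (gridLo m') (gridHi m') ∧
      Icc (gridLo m') (gridHi m') ⊆ Icc (gridLo m) (gridHi m) := by
  classical
  obtain ⟨hxm, j, hj, hxj⟩ := hx
  rw [gridLo_lt_gridHi hN] at hj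
  have hball := mem_unitBall_pi.1 (gridCell_subset_ball hN m hxm)
  have key : ∀ b : Fin (2 * N - 1), (b : ℕ) % 2 = 1 → gridPt N ((b + 1) / 2) = x j →
      ∃ m' : ι → Fin (2 * N - 1), gridDim m' < gridDim m ∧
      x ∈ Icc (gridLo m') (gridHi m') ∧
      Icc (gridLo m') (gridHi m') ⊆ Icc (gridLo m) (gridHi m) := by
    intro b hb hbx
    have hbx' : gridPt N (b / 2 + 1) = x j := by
      rw [← hbx]; congr 1; omega
    refine ⟨Function.update m j b, ?_, ⟨?_, ?_⟩, ?_⟩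
    · refine Finset.card_lt_card ⟨?_, ?_⟩
      · intro i hi
        simp only [Finset.mem_filter, Finset.mem_univ, true_and] at hi ⊢
        by_cases hij : i = j
        · subst hij; exact hj
        · simpa [hij] using hi
      · intro h
        have := h (x := j) (by simp [hj])
        simp [hb] at this
    · intro i
      by_cases hij : i = j
      · subst hij; simp [gridLo, hbx]
      · simpa [gridLo, hij] using hxm.1 i
    · intro i
      by_cases hij : i = j
      · subst hij; simp [gridHi, hbx']
      · simpa [gridHi, hij] using hxm.2 i
    · refine Icc_subset_Icc ?_ ?_
      · intro i
        by_cases hij : i = j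
        · subst hij; simpa [gridLo, hbx] using hxm.1 i
        · simp [gridLo, hij]
      · intro i
        by_cases hij : i = j
        · subst hij; simpa [gridHi, hbx'] using hxm.2 i
        · simp [gridHi, hij]
  have hlt := (m j).2
  rcases hxj with h | h
  · by_cases h0 : (m j : ℕ) = 0
    · left
      refine mem_unitSphere_pi.2 ⟨hball, j, ?_⟩
      rw [h, gridLo, h0, gridPt_zero]; simp
    · right
      refine key ⟨m j - 1, by omega⟩ (by dsimp only; omega) ?_
      rw [h, gridLo]; congr 1; dsimp only; omega
  · by_cases h0 : (m j : ℕ) / 2 + 1 = N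
    · left
      refine mem_unitSphere_pi.2 ⟨hball, j, ?_⟩
      rw [h, gridHi, h0, gridPt_self hN]; simp
    · right
      refine key ⟨m j + 1, by omega⟩ (by dsimp only; omega) ?_
      rw [h, gridHi]; congr 1; dsimp only; omega

lemma gridCell_inter_sphere (hN : 0 < N) (m : ι → Fin (2 * N - 1)) :
    Icc (gridLo m) (gridHi m) ∩ sphere 0 1 ⊆ gridBd m := by
  rintro x ⟨hx, hs⟩
  obtain ⟨-, j, hj⟩ := mem_unitSphere_pi.1 hs
  have hlt := (m j).2
  refine ⟨hx, j, ?_⟩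
  rw [gridLo_lt_gridHi hN]
  have h1 := hx.1 j
  have h2 := hx.2 j
  rcases eq_or_eq_neg_of_abs_eq hj with h | h
  · rw [h, gridHi, ← gridPt_self hN, (gridPt_strictMono hN).le_iff_le] at h2
    have hm : (m j : ℕ) / 2 + 1 = N := by omega
    refine ⟨by omega, Or.inr ?_⟩
    rw [h, gridHi, hm, gridPt_self hN]
  · rw [h, gridLo, ← gridPt_zero N, (gridPt_strictMono hN).le_iff_le] at h1
    have hm : (m j : ℕ) = 0 := by omega
    refine ⟨by omega, Or.inl ?_⟩
    rw [h, gridLo, hm, gridPt_zero]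

lemma gridCell_inter_gridCell (hN : 0 < N) (m m' : ι → Fin (2 * N - 1)) (hne : m ≠ m')
    (hd : gridDim m' ≤ gridDim m) :
    Icc (gridLo m) (gridHi m) ∩ Icc (gridLo m') (gridHi m') ⊆ gridBd m := by
  rintro x ⟨hx, hx'⟩
  by_contra hb
  have hP := gridPt_strictMono hN
  have hlo : ∀ j, (m j : ℕ) % 2 = 0 → m' j = m j := by
    intro j hj
    have hlt := (gridLo_lt_gridHi hN m j).2 hj
    have h1 : gridLo m j < x j := lt_of_le_of_ne (hx.1 j)
      fun h => hb ⟨hx, j, hlt, Or.inl h.symm⟩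
    have h2 : x j < gridHi m j := lt_of_le_of_ne (hx.2 j)
      fun h => hb ⟨hx, j, hlt, Or.inr h⟩
    have h3 := hP.lt_iff_lt.1 (h1.trans_le (hx'.2 j))
    have h4 := hP.lt_iff_lt.1 ((hx'.1 j).trans_lt h2)
    ext
    omega
  have hsub : (Finset.univ.filter fun j => (m j : ℕ) % 2 = 0) ⊆
      Finset.univ.filter fun j => (m' j : ℕ) % 2 = 0 := by
    intro j hj
    simp only [Finset.mem_filter, Finset.mem_univ, true_and] at hj ⊢
    rw [hlo j hj, hj]
  have heq := Finset.eq_of_subset_of_card_le hsub hd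
  refine hne (funext fun j => ?_)
  by_cases hj : (m j : ℕ) % 2 = 0
  · exact (hlo j hj).symm
  · have hj' : ¬ (m' j : ℕ) % 2 = 0 := by
      intro h
      have : j ∈ Finset.univ.filter fun j => (m' j : ℕ) % 2 = 0 := by simp [h]
      rw [← heq] at this
      exact hj (by simpa using this)
    have h1 := hP.le_iff_le.1 ((hx.1 j).trans (hx'.2 j))
    have h2 := hP.le_iff_le.1 ((hx'.1 j).trans (hx.2 j))
    ext
    omega

end Grid

section Gluing

open Set Metric Topology

/-- If a map from a sphere to `A ∪ B` sends every point, together with a neighbourhood, to `A` or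
to `B`, and `A`, `B` and `A ∩ B` are sufficiently connected, then the sphere bounds in `A ∪ B`. -/
lemma HasFilling.union {E : Type*} [TopologicalSpace E] {A B : Set E} {n : ℤ}
    (hA : ExtConn A n) (hB : ExtConn B n) (hAB : ExtConn (A ∩ B) (n - 1))
    {ι : Type} [Fintype ι] (hι : (Fintype.card ι : ℤ) ≤ n + 1) (f : (ι → ℝ) → E)
    (fc : ContinuousOn f (sphere 0 1))
    (hloc : ∀ x ∈ sphere (0 : ι → ℝ) 1,
      (∀ᶠ y in 𝓝[sphere 0 1] x, f y ∈ A) ∨ ∀ᶠ y in 𝓝[sphere 0 1] x, f y ∈ B) :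
    HasFilling (A ∪ B) f := by
  classical
  obtain ⟨δ, hδ, hδc⟩ : ∃ δ > 0, ∀ x ∈ sphere (0 : ι → ℝ) 1,
      MapsTo f (ball x δ ∩ sphere 0 1) A ∨ MapsTo f (ball x δ ∩ sphere 0 1) B := by
    have hO : ∀ x : sphere (0 : ι → ℝ) 1, ∃ O : Set (ι → ℝ), IsOpen O ∧ x.1 ∈ O ∧
        (MapsTo f (O ∩ sphere 0 1) A ∨ MapsTo f (O ∩ sphere 0 1) B) := by
      rintro ⟨x, hx⟩
      rcases hloc x hx with h | h <;> obtain ⟨O, hO, hxO, hOs⟩ := mem_nhdsWithin.1 h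
      · exact ⟨O, hO, hxO, Or.inl hOs⟩
      · exact ⟨O, hO, hxO, Or.inr hOs⟩
    choose O hO hxO hOs using hO
    obtain ⟨δ, hδ, h⟩ := lebesgue_number_lemma_of_metric (isCompact_sphere (0 : ι → ℝ) 1) hO
      fun x hx => mem_iUnion.2 ⟨⟨x, hx⟩, hxO ⟨x, hx⟩⟩
    refine ⟨δ, hδ, fun x hx => ?_⟩
    obtain ⟨i, hi⟩ := h x hx
    exact (hOs i).imp (fun h => h.mono_left (inter_subset_inter_left _ hi))
      fun h => h.mono_left (inter_subset_inter_left _ hi)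
  obtain ⟨N, hNδ⟩ := exists_nat_gt (2 / δ)
  have hN' : (0 : ℝ) < N := lt_trans (by positivity) hNδ
  have hN : 0 < N := by exact_mod_cast hN'
  have hNδ' : 2 / N < δ := by rwa [div_lt_comm₀ hN' hδ]
  let cell : (ι → Fin (2 * N - 1)) → Set (ι → ℝ) := fun m => Icc (gridLo m) (gridHi m)
  have hcell : ∀ m, MapsTo f (cell m ∩ sphere 0 1) A ∨ MapsTo f (cell m ∩ sphere 0 1) B := by
    intro m
    by_cases hne : (cell m ∩ sphere 0 1).Nonempty
    · obtain ⟨x, hx, hxs⟩ := hne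
      have : cell m ⊆ ball x δ := fun y hy => dist_lt_of_mem_gridCell hN hNδ' m hy hx
      exact (hδc x hxs).imp (fun h => h.mono_left (inter_subset_inter_left _ this))
        fun h => h.mono_left (inter_subset_inter_left _ this)
    · rw [not_nonempty_iff_eq_empty.1 hne]
      exact Or.inl (mapsTo_empty _ _)
  let isB : (ι → Fin (2 * N - 1)) → Prop := fun m => ¬ MapsTo f (cell m ∩ sphere 0 1) A
  have hisB : ∀ m, isB m → MapsTo f (cell m ∩ sphere 0 1) B := fun m h => (hcell m).resolve_left h
  let faceB : (ι → Fin (2 * N - 1)) → Prop := fun m =>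
    ∃ m', gridDim m < gridDim m' ∧ cell m ⊆ cell m' ∧ isB m'
  let Φ : (ι → Fin (2 * N - 1)) → Set E := fun m =>
    if isB m then B else if faceB m then A ∩ B else A
  have hΦB : ∀ m, isB m → Φ m = B := fun m h => if_pos h
  have hΦAB : ∀ m, ¬ isB m → faceB m → Φ m = A ∩ B := fun m h h' => by simp [Φ, h, h']
  have hΦA : ∀ m, ¬ isB m → ¬ faceB m → Φ m = A := fun m h h' => by simp [Φ, h, h']
  have isB_mono : ∀ m m', cell m' ⊆ cell m → isB m' → isB m := fun m m' h hm' hm =>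
    hm' (hm.mono_left (inter_subset_inter_left _ h))
  have hΦmono : ∀ m m', gridDim m' < gridDim m → cell m' ⊆ cell m → Φ m' ⊆ Φ m := by
    intro m m' hd hc
    by_cases hm : isB m
    · rw [hΦB m hm]
      by_cases hm' : isB m'
      · rw [hΦB m' hm']
      · rw [hΦAB m' hm' ⟨m, hd, hc, hm⟩]; exact inter_subset_right
    · have hm' : ¬ isB m' := fun h => hm (isB_mono m m' hc h)
      by_cases hf : faceB m
      · obtain ⟨m₁, hd₁, hc₁, hb₁⟩ := hf
        rw [hΦAB m hm ⟨m₁, hd₁, hc₁, hb₁⟩,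
          hΦAB m' hm' ⟨m₁, hd.trans hd₁, hc.trans hc₁, hb₁⟩]
      · rw [hΦA m hm hf]
        by_cases hf' : faceB m'
        · rw [hΦAB m' hm' hf']; exact inter_subset_left
        · rw [hΦA m' hm' hf']
  have hdim : ∀ m : ι → Fin (2 * N - 1), gridDim m ≤ Fintype.card ι := fun m =>
    Finset.card_le_univ _
  obtain ⟨g, gc, ge, gm⟩ := exists_extension_cells cell gridBd Φ gridDim (sphere 0 1)
    isClosed_sphere f fc (fun m => isClosed_Icc) (fun m x hx => hx.1)
    (fun m x hx => (gridBd_cover hN m hx).imp_right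
      fun ⟨m', hd, hx', hc⟩ => ⟨m', hd, hx', hΦmono m m' hd hc⟩)
    (gridCell_inter_sphere hN) (gridCell_inter_gridCell hN)
    (by
      intro m
      by_cases hm : isB m
      · rw [hΦB m hm]; exact hisB m hm
      · by_cases hf : faceB m
        · rw [hΦAB m hm hf]
          obtain ⟨m', -, hc, hb⟩ := hf
          exact (not_not.1 hm).inter ((hisB m' hb).mono_left (inter_subset_inter_left _ hc))
        · rw [hΦA m hm hf]; exact not_not.1 hm)
    (by
      intro m g gc gm
      have hd := hdim m
      by_cases hm : isB m
      · rw [hΦB m hm] at gm ⊢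
        exact hB.extend_box n _ _ (by rw [card_gridDim hN]; omega) g gc gm (gridLo_le_gridHi hN m)
      · by_cases hf : faceB m
        · rw [hΦAB m hm hf] at gm ⊢
          obtain ⟨m', hlt, -, -⟩ := hf
          have hd' := hdim m'
          exact hAB.extend_box (n - 1) _ _ (by rw [card_gridDim hN]; omega) g gc gm
            (gridLo_le_gridHi hN m)
        · rw [hΦA m hm hf] at gm ⊢
          exact hA.extend_box n _ _ (by rw [card_gridDim hN]; omega) g gc gm
            (gridLo_le_gridHi hN m))
  refine ⟨g, gc.mono (ball_subset_gridCells hN), ?_, ge⟩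
  intro x hx
  rcases ball_subset_gridCells hN hx with h | h
  · rw [ge h]
    rcases hloc x h with h' | h'
    · exact Or.inl (h'.self_of_nhdsWithin h)
    · exact Or.inr (h'.self_of_nhdsWithin h)
  · obtain ⟨m, hm⟩ := mem_iUnion.1 h
    have := gm m hm
    by_cases hb : isB m
    · rw [hΦB m hb] at this; exact Or.inr this
    · by_cases hf : faceB m
      · rw [hΦAB m hb hf] at this; exact Or.inl this.1
      · rw [hΦA m hb hf] at this; exact Or.inl this

end Gluing

section HomotopyGroups

open Set Metric unitInterval

/-- The affine identification of `[0, 1]^i` with `[-1, 1]^i`. -/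
def ofUnitCube {i : ℕ} (u : Fin i → I) : Fin i → ℝ := fun j => 2 * (u j : ℝ) - 1

/-- The inverse of `ofUnitCube`, precomposed with the projection to `[-1, 1]^i`. -/
noncomputable def toUnitCube {i : ℕ} (y : Fin i → ℝ) : Fin i → I :=
  fun j => projIcc 0 1 zero_le_one ((y j + 1) / 2)

variable {i : ℕ}

lemma continuous_ofUnitCube : Continuous (ofUnitCube (i := i)) := by
  unfold ofUnitCube; fun_prop

lemma continuous_toUnitCube : Continuous (toUnitCube (i := i)) :=
  continuous_pi fun _ => continuous_projIcc.comp (by fun_prop)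

lemma toUnitCube_ofUnitCube (u : Fin i → I) : toUnitCube (ofUnitCube u) = u := by
  ext j
  simp [toUnitCube, ofUnitCube, projIcc_val]

lemma ofUnitCube_toUnitCube {y : Fin i → ℝ} (hy : y ∈ closedBall (0 : Fin i → ℝ) 1) :
    ofUnitCube (toUnitCube y) = y := by
  ext j
  have := abs_le.1 (mem_unitBall_pi.1 hy j)
  simp only [toUnitCube, ofUnitCube]
  rw [projIcc_of_mem zero_le_one (show (y j + 1) / 2 ∈ Icc (0 : ℝ) 1 from
    ⟨by linarith, by linarith⟩)]
  dsimp only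
  ring

lemma ofUnitCube_mem_ball (u : Fin i → I) : ofUnitCube u ∈ closedBall (0 : Fin i → ℝ) 1 := by
  rw [mem_unitBall_pi]
  intro j
  have h0 := (u j).2.1
  have h1 := (u j).2.2
  rw [ofUnitCube, abs_le]
  constructor <;> linarith

lemma ofUnitCube_mem_sphere {u : Fin i → I} :
    ofUnitCube u ∈ sphere (0 : Fin i → ℝ) 1 ↔ u ∈ Cube.boundary (Fin i) := by
  rw [mem_unitSphere_pi, and_iff_right (mem_unitBall_pi.1 (ofUnitCube_mem_ball u))]
  refine exists_congr fun j => ?_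
  simp only [ofUnitCube, Subtype.ext_iff, Icc.coe_zero, Icc.coe_one]
  rw [abs_eq zero_le_one]
  constructor
  · rintro (h | h)
    · right; linarith
    · left; linarith
  · rintro (h | h) <;> rw [h] <;> norm_num

lemma mem_unitBall_cons {z : ℝ} {y : Fin i → ℝ} :
    (Fin.cons z y : Fin (i + 1) → ℝ) ∈ closedBall (0 : Fin (i + 1) → ℝ) 1 ↔
      |z| ≤ 1 ∧ y ∈ closedBall (0 : Fin i → ℝ) 1 := by
  rw [mem_unitBall_pi, mem_unitBall_pi, Fin.forall_fin_succ]
  simp only [Fin.cons_zero, Fin.cons_succ]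

lemma mem_unitSphere_cons {z : ℝ} {y : Fin i → ℝ} :
    (Fin.cons z y : Fin (i + 1) → ℝ) ∈ sphere (0 : Fin (i + 1) → ℝ) 1 ↔
      (|z| ≤ 1 ∧ y ∈ closedBall (0 : Fin i → ℝ) 1) ∧
        (|z| = 1 ∨ y ∈ sphere (0 : Fin i → ℝ) 1) := by
  simp only [mem_unitSphere_pi, mem_unitBall_pi, Fin.forall_fin_succ, Fin.exists_fin_succ,
    Fin.cons_zero, Fin.cons_succ]
  tauto

lemma continuous_finCons {X : Type*} [TopologicalSpace X] {z : X → ℝ} {y : X → Fin i → ℝ}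
    (hz : Continuous z) (hy : Continuous y) :
    Continuous fun x => (Fin.cons (z x) (y x) : Fin (i + 1) → ℝ) := by
  refine continuous_pi fun j => ?_
  refine Fin.cases ?_ (fun j => ?_) j
  · simpa using hz
  · simp only [Fin.cons_succ]
    fun_prop

/-- The non-normalized form of `boxContract`. -/
noncomputable def boxPush (t : ℝ) (x : Fin (i + 1) → ℝ) : Fin (i + 1) → ℝ :=
  Fin.cons (x 0 - 2 * (t * max ‖Fin.tail x‖ ((1 - x 0) / 2)))
    ((1 - t * max ‖Fin.tail x‖ ((1 - x 0) / 2)) • Fin.tail x)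

/-- A homotopy of the boundary of the cube, starting at the identity and contracting the union of
all facets except the top one (where the coordinate `0` is `1`) to a point. -/
noncomputable def boxContract (t : ℝ) (x : Fin (i + 1) → ℝ) : Fin (i + 1) → ℝ :=
  ‖boxPush t x‖⁻¹ • boxPush t x

lemma continuous_boxPush :
    Continuous fun p : ℝ × (Fin (i + 1) → ℝ) => boxPush p.1 p.2 := by
  have : Continuous fun x : Fin (i + 1) → ℝ => Fin.tail x :=
    continuous_pi fun j => continuous_apply _
  refine continuous_finCons ?_ ?_ <;> fun_prop

lemma boxPush_ne_zero {t : ℝ} (ht : t ∈ Icc (0 : ℝ) 1) {x : Fin (i + 1) → ℝ}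
    (hx : x ∈ sphere (0 : Fin (i + 1) → ℝ) 1) : boxPush t x ≠ 0 := by
  intro h
  have h0 := congrFun h 0
  have h1 : (1 - t * max ‖Fin.tail x‖ ((1 - x 0) / 2)) • Fin.tail x = 0 := by
    ext j
    simpa [boxPush] using congrFun h j.succ
  simp only [boxPush, Fin.cons_zero, Pi.zero_apply] at h0
  rw [← Fin.cons_self_tail x, mem_unitSphere_cons] at hx
  obtain ⟨⟨hz, hy⟩, hor⟩ := hx
  have hz' := abs_le.1 hz
  rcases smul_eq_zero.1 h1 with h2 | h2
  · linarith
  · rw [h2] at hor h0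
    rcases hor with h3 | h3
    · rcases eq_or_eq_neg_of_abs_eq h3 with h4 | h4
      · rw [h4] at h0; norm_num at h0
      · rw [h4] at h0
        norm_num at h0
        linarith [ht.1]
    · simp at h3

lemma boxContract_mem {t : ℝ} (ht : t ∈ Icc (0 : ℝ) 1) {x : Fin (i + 1) → ℝ}
    (hx : x ∈ sphere (0 : Fin (i + 1) → ℝ) 1) :
    boxContract t x ∈ sphere (0 : Fin (i + 1) → ℝ) 1 := by
  rw [mem_sphere_zero_iff_norm, boxContract, norm_smul, norm_inv, norm_norm]
  exact inv_mul_cancel₀ (norm_ne_zero_iff.2 (boxPush_ne_zero ht hx))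

lemma continuousOn_boxContract :
    ContinuousOn (fun p : ℝ × (Fin (i + 1) → ℝ) => boxContract p.1 p.2)
      (Icc 0 1 ×ˢ sphere 0 1) := by
  have h : ContinuousOn (fun p : ℝ × (Fin (i + 1) → ℝ) => ‖boxPush p.1 p.2‖⁻¹)
      (Icc 0 1 ×ˢ sphere 0 1) := continuous_boxPush.norm.continuousOn.inv₀
    fun p hp => norm_ne_zero_iff.2 (boxPush_ne_zero hp.1 hp.2)
  exact h.smul continuous_boxPush.continuousOn

lemma boxContract_zero {x : Fin (i + 1) → ℝ} (hx : x ∈ sphere (0 : Fin (i + 1) → ℝ) 1) :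
    boxContract 0 x = x := by
  have : boxPush 0 x = x := by simp [boxPush]
  rw [boxContract, this, mem_sphere_zero_iff_norm.1 hx]
  simp

lemma boxContract_one {z : ℝ} {y : Fin i → ℝ} (hz : |z| ≤ 1)
    (hy : y ∈ closedBall (0 : Fin i → ℝ) 1) (h : z = -1 ∨ y ∈ sphere (0 : Fin i → ℝ) 1) :
    boxContract 1 (Fin.cons z y : Fin (i + 1) → ℝ) = Fin.cons (-1) 0 := by
  have hz' := abs_le.1 hz
  rw [mem_closedBall_zero_iff] at hy
  have ha : max ‖y‖ ((1 - z) / 2) = 1 := by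
    rcases h with h | h
    · rw [h, max_eq_right] <;> linarith
    · rw [mem_sphere_zero_iff_norm.1 h, max_eq_left]; linarith
  have hp : boxPush 1 (Fin.cons z y : Fin (i + 1) → ℝ) = (2 - z) • Fin.cons (-1) 0 := by
    ext j
    refine Fin.cases ?_ (fun j => ?_) j
    · simp [boxPush, ha]
    · simp [boxPush, ha]
  have hn : ‖(Fin.cons (-1) 0 : Fin (i + 1) → ℝ)‖ = 1 := by
    rw [← mem_sphere_zero_iff_norm, mem_unitSphere_cons]
    simp
  have h2 : 0 < 2 - z := by linarith
  rw [boxContract, hp, norm_smul, hn, smul_smul, Real.norm_of_nonneg h2.le, mul_one,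
    inv_mul_cancel₀ h2.ne', one_smul]

variable {E : Type} [TopologicalSpace E] {S : Set E}

lemma HasFilling.of_homotopyGroup (f : (Fin (i + 1) → ℝ) → E) (fc : ContinuousOn f (sphere 0 1))
    (fm : MapsTo f (sphere 0 1) S)
    (hS : ∀ x : S, Subsingleton (HomotopyGroup (Fin i) S x)) : HasFilling S f := by
  suffices h : HasFilling S fun x => f (boxContract 0 x) by
    obtain ⟨g, gc, gm, ge⟩ := h
    exact ⟨g, gc, gm, fun x hx => (ge hx).trans (congrArg f (boxContract_zero hx))⟩
  refine HasFilling.of_homotopy (fun t x => f (boxContract t x))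
    (fc.comp continuousOn_boxContract fun p hp => boxContract_mem hp.1 hp.2)
    (fun t ht x hx => fm (boxContract_mem ht hx)) ?_
  have h01 : (1 : ℝ) ∈ Icc (0 : ℝ) 1 := by simp
  have htop : ∀ u : Fin i → I,
      (Fin.cons 1 (ofUnitCube u) : Fin (i + 1) → ℝ) ∈ sphere (0 : Fin (i + 1) → ℝ) 1 := by
    intro u
    rw [mem_unitSphere_cons]
    simpa using ofUnitCube_mem_ball u
  have hp0 : (Fin.cons (-1) 0 : Fin (i + 1) → ℝ) ∈ sphere (0 : Fin (i + 1) → ℝ) 1 := by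
    rw [mem_unitSphere_cons]; simp
  let x₀ : S := ⟨f (Fin.cons (-1) 0), fm hp0⟩
  let P : GenLoop (Fin i) S x₀ := ⟨⟨fun u => ⟨f (boxContract 1 (Fin.cons 1 (ofUnitCube u))),
      fm (boxContract_mem h01 (htop u))⟩, by
        refine Continuous.subtype_mk ?_ _
        refine (fc.comp continuousOn_boxContract fun p hp => boxContract_mem hp.1 hp.2).comp_continuous
          (f := fun u => ((1 : ℝ), (Fin.cons 1 (ofUnitCube u) : Fin (i + 1) → ℝ))) ?_ ?_
        · exact continuous_const.prodMk (continuous_finCons continuous_const continuous_ofUnitCube)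
        · exact fun u => ⟨h01, htop u⟩⟩, by
      intro u hu
      refine Subtype.ext ?_
      change f (boxContract 1 (Fin.cons 1 (ofUnitCube u))) = _
      rw [boxContract_one (by simp) (ofUnitCube_mem_ball u)
        (Or.inr (ofUnitCube_mem_sphere.2 hu))]⟩
  have hP : GenLoop.Homotopic P GenLoop.const :=
    Quotient.exact ((hS x₀).elim (Quotient.mk _ P) (Quotient.mk _ GenLoop.const))
  obtain ⟨H⟩ := hP
  have htail : Continuous fun x : Fin (i + 1) → ℝ => Fin.tail x :=
    continuous_pi fun j => continuous_apply _
  refine ⟨fun x => H (projIcc 0 1 zero_le_one ((1 - x 0) / 2), toUnitCube (Fin.tail x)), ?_,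
    fun x _ => Subtype.coe_prop _, ?_⟩
  · refine Continuous.continuousOn ?_
    refine continuous_subtype_val.comp (H.continuous.comp (Continuous.prodMk ?_ ?_))
    · exact continuous_projIcc.comp (by fun_prop)
    · exact continuous_toUnitCube.comp htail
  · intro x hx
    obtain ⟨z, y, rfl⟩ : ∃ z y, x = (Fin.cons z y : Fin (i + 1) → ℝ) :=
      ⟨x 0, Fin.tail x, (Fin.cons_self_tail x).symm⟩
    obtain ⟨⟨hz, hy⟩, h⟩ := mem_unitSphere_cons.1 hx
    simp only [Fin.cons_zero, Fin.tail_cons]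
    by_cases h1 : z = -1 ∨ y ∈ sphere (0 : Fin i → ℝ) 1
    · rw [boxContract_one hz hy h1]
      rcases h1 with h1 | h1
      · rw [h1, show ((1 : ℝ) - -1) / 2 = 1 by norm_num, projIcc_right]
        exact congrArg Subtype.val (H.apply_one _)
      · have hb : toUnitCube y ∈ Cube.boundary (Fin i) := by
          rw [← ofUnitCube_mem_sphere, ofUnitCube_toUnitCube hy]; exact h1
        have := H.eq_fst (projIcc 0 1 zero_le_one ((1 - z) / 2)) hb
        rw [this]
        exact congrArg Subtype.val (P.2 _ hb)
    · rw [not_or] at h1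
      have hz1 : z = 1 :=
        (eq_or_eq_neg_of_abs_eq (h.resolve_right h1.2)).resolve_right h1.1
      rw [hz1, show ((1 : ℝ) - 1) / 2 = 0 by norm_num, projIcc_left]
      refine (congrArg Subtype.val (H.apply_zero _)).trans ?_
      change f (boxContract 1 (Fin.cons 1 (ofUnitCube (toUnitCube y)))) = _
      rw [ofUnitCube_toUnitCube hy]

lemma IsConn.extConn {n : ℤ} (h : IsConn S n) : ExtConn S n := by
  intro ι _ hι f fc fm
  rcases hk : Fintype.card ι with _ | i
  · have := Fintype.card_eq_zero_iff.1 hk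
    obtain ⟨s⟩ := h.1 (by omega)
    refine ⟨fun _ => s, continuousOn_const, fun _ _ => s.2, fun x hx => ?_⟩
    obtain ⟨-, j, -⟩ := mem_unitSphere_pi.1 hx
    exact this.elim j
  · let e : ι ≃ Fin (i + 1) := Fintype.equivFinOfCardEq hk
    refine HasFilling.exists_extension (κ := Fin (i + 1)) (fun y j => y (e j))
      (fun x j => x (e.symm j)) (by fun_prop) (by fun_prop) ?_ ?_ ?_ (by simp)
      (fun f fc fm => HasFilling.of_homotopyGroup f fc fm (h.2 i (by omega))) f fc fm
    · intro y hy
      rw [mem_unitSphere_pi] at hy ⊢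
      exact ⟨fun j => hy.1 _, by simpa using (e.exists_congr_left).2 (by simpa using hy.2)⟩
    · intro x hx
      rw [mem_unitBall_pi] at hx ⊢
      exact fun j => hx _
    · intro x hx
      rw [mem_unitSphere_pi] at hx ⊢
      exact ⟨fun j => hx.1 _, by simpa using (e.symm.exists_congr_left).2 (by simpa using hx.2)⟩

lemma ExtConn.isConn [Nonempty E] {n : ℤ} (h : ExtConn S n) : IsConn S n := by
  constructor
  · intro hn
    obtain ⟨g, -, gm, -⟩ := h (Fin 0) (by simp; omega) (fun _ => Classical.arbitrary E)
      continuousOn_const fun x hx => by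
        obtain ⟨-, j, -⟩ := mem_unitSphere_pi.1 hx
        exact j.elim0
    exact ⟨⟨g 0, gm (by simp)⟩⟩
  · intro i hi x₀
    constructor
    refine Quotient.ind₂ fun p q => Quotient.sound ?_
    let f : (Fin (i + 1) → ℝ) → E := fun x =>
      if x 0 ≤ 0 then p (toUnitCube (Fin.tail x)) else q (toUnitCube (Fin.tail x))
    have htail : Continuous fun x : Fin (i + 1) → ℝ => Fin.tail x :=
      continuous_pi fun j => continuous_apply _
    have hr : ∀ r : GenLoop (Fin i) S x₀, Continuous fun x : Fin (i + 1) → ℝ =>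
        (r (toUnitCube (Fin.tail x)) : E) := fun r =>
      continuous_subtype_val.comp (r.1.continuous.comp (continuous_toUnitCube.comp htail))
    have hbd : ∀ r : GenLoop (Fin i) S x₀, ∀ y ∈ sphere (0 : Fin i → ℝ) 1,
        r (toUnitCube y) = x₀ := by
      intro r y hy
      refine r.2 _ ?_
      rwa [← ofUnitCube_mem_sphere, ofUnitCube_toUnitCube (sphere_subset_closedBall hy)]
    have fc : ContinuousOn f (sphere 0 1) := by
      have e : sphere (0 : Fin (i + 1) → ℝ) 1 =
          (sphere 0 1 ∩ {x | x 0 ≤ 0}) ∪ (sphere 0 1 ∩ {x | 0 ≤ x 0}) := by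
        rw [← inter_union_distrib_left]
        refine (inter_eq_left.2 fun x _ => ?_).symm
        exact le_total (x 0) 0
      rw [e]
      refine ContinuousOn.union_of_isClosed ?_ ?_
        (isClosed_sphere.inter (isClosed_le (continuous_apply 0) continuous_const))
        (isClosed_sphere.inter (isClosed_le continuous_const (continuous_apply 0)))
      · exact (hr p).continuousOn.congr fun x hx => if_pos hx.2
      · refine (hr q).continuousOn.congr fun x hx => ?_
        by_cases h0 : x 0 ≤ 0
        · have h1 : x 0 = 0 := le_antisymm h0 hx.2
          have h2 := hx.1
          rw [← Fin.cons_self_tail x, mem_unitSphere_cons, h1] at h2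
          have h3 := h2.2.resolve_left (by simp)
          refine (if_pos h0).trans ?_
          exact congrArg Subtype.val ((hbd p _ h3).trans (hbd q _ h3).symm)
        · exact if_neg h0
    obtain ⟨g, gc, gm, ge⟩ := h (Fin (i + 1)) (by simp; omega) f fc (by
      intro x _
      by_cases h0 : x 0 ≤ 0 <;> simp [f, h0])
    have hmem : ∀ a : I × (Fin i → I),
        (Fin.cons (2 * (a.1 : ℝ) - 1) (ofUnitCube a.2) : Fin (i + 1) → ℝ) ∈
          closedBall (0 : Fin (i + 1) → ℝ) 1 := by
      intro a
      refine mem_unitBall_cons.2 ⟨?_, ofUnitCube_mem_ball _⟩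
      have := a.1.2.1
      have := a.1.2.2
      rw [abs_le]
      constructor <;> linarith
    have hsph : ∀ z : ℝ, ∀ u : Fin i → I, |z| ≤ 1 → (|z| = 1 ∨ u ∈ Cube.boundary (Fin i)) →
        g (Fin.cons z (ofUnitCube u)) = if z ≤ 0 then (p u : E) else q u := by
      intro z u hz hor
      rw [ge (mem_unitSphere_cons.2 ⟨⟨hz, ofUnitCube_mem_ball u⟩,
        hor.imp_right ofUnitCube_mem_sphere.2⟩)]
      simp [f, toUnitCube_ofUnitCube]
    refine ⟨⟨⟨⟨fun a => ⟨g (Fin.cons (2 * (a.1 : ℝ) - 1) (ofUnitCube a.2)), gm (hmem a)⟩, ?_⟩,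
      ?_, ?_⟩, ?_⟩⟩
    · refine Continuous.subtype_mk (gc.comp_continuous ?_ hmem) _
      exact continuous_finCons (by fun_prop) (continuous_ofUnitCube.comp continuous_snd)
    · intro u
      refine Subtype.ext ?_
      simpa using hsph (-1) u (by simp) (by simp)
    · intro u
      refine Subtype.ext ?_
      have := hsph 1 u (by simp) (by simp)
      norm_num at this ⊢
      exact this
    · intro t u hu
      refine Subtype.ext ?_
      have := hsph (2 * t - 1) u (mem_unitBall_cons.1 (hmem (t, u))).1 (Or.inr hu)
      refine this.trans ?_
      split_ifs
      · rfl
      · exact congrArg Subtype.val ((q.2 u hu).trans (p.2 u hu).symm)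

end HomotopyGroups

section Realization

open Set Metric Topology

/-- The closed simplex with vertex set `s`, in barycentric coordinates. -/
def closedSimplex {V : Type*} (s : Finset V) : Set (V → ℝ) :=
  {x | (∀ v, 0 ≤ x v) ∧ (∀ v, v ∉ s → x v = 0) ∧ ∑ v ∈ s, x v = 1}

variable {V : Type} {s t : Finset V} {x y : V → ℝ}

lemma sum_eq_of_mem_closedSimplex (hx : x ∈ closedSimplex s) (ht : ∀ v, v ∉ t → x v = 0) :
    ∑ v ∈ t, x v = 1 := by
  classical
  rw [← hx.2.2, Finset.sum_subset Finset.subset_union_left (s₂ := t ∪ s) fun v _ h => ht v h,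
    Finset.sum_subset Finset.subset_union_right (s₂ := t ∪ s) fun v _ h => hx.2.1 v h]

lemma mem_closedSimplex_of_support (hx : x ∈ closedSimplex s) (ht : ∀ v, v ∉ t → x v = 0) :
    x ∈ closedSimplex t :=
  ⟨hx.1, ht, sum_eq_of_mem_closedSimplex hx ht⟩

lemma sum_le_one_of_mem_closedSimplex (hx : x ∈ closedSimplex s) (t : Finset V) :
    ∑ v ∈ t, x v ≤ 1 := by
  classical
  rw [← sum_eq_of_mem_closedSimplex hx (t := t ∪ s)
    fun v hv => hx.2.1 v fun h => hv (Finset.mem_union_right _ h)]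
  exact Finset.sum_le_sum_of_subset_of_nonneg Finset.subset_union_left fun v _ _ => hx.1 v

lemma convex_closedSimplex (s : Finset V) : Convex ℝ (closedSimplex s) := by
  intro x hx y hy a b ha hb hab
  refine ⟨fun v => ?_, fun v hv => ?_, ?_⟩
  · have := hx.1 v
    have := hy.1 v
    simp only [Pi.add_apply, Pi.smul_apply, smul_eq_mul]
    positivity
  · simp [hx.2.1 v hv, hy.2.1 v hv]
  · simp [Finset.sum_add_distrib, ← Finset.mul_sum, hx.2.2, hy.2.2, hab]

namespace ASC

variable {K A B : ASC V}

lemma mem_space_iff : x ∈ K.space ↔ ∃ s ∈ K.faces, x ∈ closedSimplex s :=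
  ⟨fun ⟨h0, s, hs, h1, h2⟩ => ⟨s, hs, h0, h1, h2⟩, fun ⟨s, hs, h0, h1, h2⟩ => ⟨h0, s, hs, h1, h2⟩⟩

lemma space_mono (h : A.faces ⊆ B.faces) : A.space ⊆ B.space := by
  intro x hx
  obtain ⟨s, hs, hx⟩ := mem_space_iff.1 hx
  exact mem_space_iff.2 ⟨s, h hs, hx⟩

lemma space_union (h : ∀ s, s ∈ K.faces ↔ s ∈ A.faces ∨ s ∈ B.faces) :
    K.space = A.space ∪ B.space := by
  ext x
  simp only [mem_union, mem_space_iff, h, or_and_right, exists_or]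

lemma space_inter (h : ∀ s, s ∈ K.faces ↔ s ∈ A.faces ∧ s ∈ B.faces) :
    K.space = A.space ∩ B.space := by
  classical
  refine Subset.antisymm (subset_inter (space_mono fun s hs => ((h s).1 hs).1)
    (space_mono fun s hs => ((h s).1 hs).2)) ?_
  rintro x ⟨hA, hB⟩
  obtain ⟨s, hs, hxs⟩ := mem_space_iff.1 hA
  obtain ⟨t, ht, hxt⟩ := mem_space_iff.1 hB
  have hx : x ∈ closedSimplex (s ∩ t) := mem_closedSimplex_of_support hxs fun v hv => by
    rw [Finset.mem_inter, not_and_or] at hv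
    exact hv.elim (hxs.2.1 v) (hxt.2.1 v)
  have hne : (s ∩ t).Nonempty := by
    rw [Finset.nonempty_iff_ne_empty]
    intro h0
    have := hx.2.2
    simp [h0] at this
  exact mem_space_iff.2 ⟨s ∩ t, (h _).2 ⟨A.down_closed hs Finset.inter_subset_left hne,
    B.down_closed ht Finset.inter_subset_right hne⟩, hx⟩

/-- A map from a compact set to the realization of a complex can be deformed, inside the closed
simplices, to a map that locally takes values in a single closed simplex. The deformation cuts off
all barycentric coordinates below a small threshold. -/
lemma exists_truncation {D : Type*} [TopologicalSpace D] {C : Set D} (hC : IsCompact C)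
    (f : D → V → ℝ) (fc : ContinuousOn f C) (fm : MapsTo f C K.space) :
    ∃ f' : D → V → ℝ, ContinuousOn f' C ∧
      (∀ p ∈ C, ∃ s ∈ K.faces, f p ∈ closedSimplex s ∧ f' p ∈ closedSimplex s) ∧
      ∀ p ∈ C, ∃ s ∈ K.faces, ∀ᶠ q in 𝓝[C] p, f' q ∈ closedSimplex s := by
  classical
  have hs : ∀ p, ∃ s : Finset V, p ∈ C → s ∈ K.faces ∧ f p ∈ closedSimplex s := by
    intro p
    by_cases hp : p ∈ C
    · obtain ⟨s, hs, h⟩ := mem_space_iff.1 (fm hp)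
      exact ⟨s, fun _ => ⟨hs, h⟩⟩
    · exact ⟨∅, fun h => absurd h hp⟩
  choose s hs using hs
  have fcv : ∀ v, ContinuousOn (fun q => f q v) C := fun v =>
    (continuous_apply v).comp_continuousOn fc
  have hnhds : ∀ c : ℝ, c < 1 → ∀ p ∈ C, {q | c < ∑ v ∈ s p, f q v} ∈ 𝓝[C] p := by
    intro c hc p hp
    have hcont : ContinuousOn (fun q => ∑ v ∈ s p, f q v) C :=
      continuousOn_finsetSum _ fun v _ => fcv v
    refine (hcont p hp).eventually_const_lt ?_
    exact hc.trans_eq (hs p hp).2.2.2.symm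
  obtain ⟨T, hTC, hT⟩ := hC.elim_nhdsWithin_subcover _ (hnhds (1 / 2) (by norm_num))
  obtain ⟨ε, hε0, hε1, hε⟩ : ∃ ε : ℝ, 0 < ε ∧ ε < 1 ∧ ∀ q ∈ C, ∃ v, ε < f q v := by
    obtain ⟨M, hM⟩ : ∃ M : ℝ, M = ∑ p ∈ T, ((s p).card : ℝ) + 1 := ⟨_, rfl⟩
    have hM1 : 1 ≤ M := by
      rw [hM]
      exact le_add_of_nonneg_left (Finset.sum_nonneg fun _ _ => Nat.cast_nonneg _)
    have hM0 : 0 < M := by linarith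
    refine ⟨1 / (2 * M), by positivity, ?_, fun q hq => ?_⟩
    · rw [div_lt_one (by positivity)]
      linarith
    · obtain ⟨p, hp, hpq⟩ := mem_iUnion₂.1 (hT hq)
      by_contra! hle
      have h1 : ∑ v ∈ s p, f q v ≤ (s p).card * (1 / (2 * M)) := by
        simpa only [nsmul_eq_mul] using Finset.sum_le_card_nsmul (s p) (f q) _ fun v _ => hle v
      have h2 : ((s p).card : ℝ) ≤ M := by
        have := Finset.single_le_sum (f := fun p => ((s p).card : ℝ))
          (fun _ _ => Nat.cast_nonneg _) hp
        linarith
      have h3 : M * (1 / (2 * M)) = 1 / 2 := by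
        have := hM0.ne'
        field_simp
      have h4 : ((s p).card : ℝ) * (1 / (2 * M)) ≤ M * (1 / (2 * M)) :=
        mul_le_mul_of_nonneg_right h2 (by positivity)
      have h5 : 1 / 2 < ∑ v ∈ s p, f q v := hpq
      linarith
  have hsmall : ∀ p ∈ C, ∀ q ∈ C, 1 - ε < ∑ v ∈ s p, f q v → ∀ v, v ∉ s p → f q v < ε := by
    intro p _ q hq hlt v hv
    have := sum_le_one_of_mem_closedSimplex (hs q hq).2 (insert v (s p))
    rw [Finset.sum_insert hv] at this
    linarith
  obtain ⟨T', hTC', hT'⟩ := hC.elim_nhdsWithin_subcover _ (hnhds (1 - ε) (by linarith))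
  let W : Finset V := T'.biUnion s
  have hW : ∀ q ∈ C, ∀ v, v ∉ W → max (f q v - ε) 0 = 0 := by
    intro q hq v hv
    obtain ⟨p, hp, hpq⟩ := mem_iUnion₂.1 (hT' hq)
    have := hsmall p (hTC' p hp) q hq hpq v fun h => hv (Finset.mem_biUnion.2 ⟨p, hp, h⟩)
    exact max_eq_right (by linarith)
  let d : D → ℝ := fun q => ∑ w ∈ W, max (f q w - ε) 0
  have hd : ∀ q ∈ C, 0 < d q := by
    intro q hq
    obtain ⟨v, hv⟩ := hε q hq
    have hvW : v ∈ W := by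
      by_contra h
      have := hW q hq v h
      rw [max_eq_left (by linarith)] at this
      linarith
    refine Finset.sum_pos' (fun _ _ => le_max_right _ _) ⟨v, hvW, ?_⟩
    exact lt_max_of_lt_left (by linarith)
  have hsupp : ∀ q ∈ C, (fun v => max (f q v - ε) 0 / d q) ∈ closedSimplex (s q) := by
    intro q hq
    have hz : ∀ v, v ∉ s q → max (f q v - ε) 0 = 0 := by
      intro v hv
      rw [(hs q hq).2.2.1 v hv]
      exact max_eq_right (by linarith)
    refine ⟨fun v => div_nonneg (le_max_right _ _) (hd q hq).le, fun v hv => ?_, ?_⟩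
    · change max (f q v - ε) 0 / d q = 0
      rw [hz v hv, zero_div]
    · change ∑ v ∈ s q, max (f q v - ε) 0 / d q = 1
      rw [← Finset.sum_div, div_eq_one_iff_eq (hd q hq).ne',
        Finset.sum_subset (Finset.subset_union_left (s₂ := W)) fun v _ h => hz v h]
      exact (Finset.sum_subset Finset.subset_union_right fun v _ h => hW q hq v h).symm
  refine ⟨fun q v => max (f q v - ε) 0 / d q, ?_,
    fun p hp => ⟨s p, (hs p hp).1, (hs p hp).2, hsupp p hp⟩,
    fun p hp => ⟨s p, (hs p hp).1, ?_⟩⟩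
  · refine continuousOn_pi.2 fun v => ?_
    change ContinuousOn (fun q => max (f q v - ε) 0 / d q) C
    have hmax : ∀ v, ContinuousOn (fun q => max (f q v - ε) 0) C := fun v =>
      ContinuousOn.sup ((fcv v).sub continuousOn_const) continuousOn_const
    exact (hmax v).div (continuousOn_finsetSum _ fun w _ => hmax w) fun q hq => (hd q hq).ne'
  · filter_upwards [hnhds (1 - ε) (by linarith) p hp, self_mem_nhdsWithin] with q hq hqC
    refine mem_closedSimplex_of_support (hsupp q hqC) fun v hv => ?_
    rw [max_eq_right (by linarith [hsmall p hp q hqC hq v hv]), zero_div]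

lemma hasFilling_of_line {ι : Type} [Fintype ι] (f f' : (ι → ℝ) → V → ℝ)
    (fc : ContinuousOn f (sphere 0 1)) (fc' : ContinuousOn f' (sphere 0 1))
    (h : ∀ p ∈ sphere (0 : ι → ℝ) 1,
      ∃ s ∈ K.faces, f p ∈ closedSimplex s ∧ f' p ∈ closedSimplex s)
    (hf' : HasFilling K.space f') : HasFilling K.space f := by
  have := HasFilling.of_homotopy (S := K.space) (fun t p => (1 - t) • f p + t • f' p)
    (by
      have h1 : ContinuousOn (fun p : ℝ × (ι → ℝ) => f p.2) (Icc 0 1 ×ˢ sphere 0 1) :=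
        fc.comp continuousOn_snd fun p hp => hp.2
      have h2 : ContinuousOn (fun p : ℝ × (ι → ℝ) => f' p.2) (Icc 0 1 ×ˢ sphere 0 1) :=
        fc'.comp continuousOn_snd fun p hp => hp.2
      have h3 : ContinuousOn (fun p : ℝ × (ι → ℝ) => p.1) (Icc 0 1 ×ˢ sphere 0 1) :=
        continuousOn_fst
      exact ((continuousOn_const.sub h3).smul h1).add (h3.smul h2))
    (fun t ht p hp => by
      obtain ⟨s, hs, h1, h2⟩ := h p hp
      exact mem_space_iff.2 ⟨s, hs, convex_closedSimplex s h1 h2 (by linarith [ht.2]) ht.1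
        (by ring)⟩)
    (by simpa using hf')
  simpa using this

/-- A union of two `n`-connected subcomplexes with `(n - 1)`-connected intersection is
`n`-connected. -/
lemma extConn_union {I : ASC V} {n : ℤ} (hK : ∀ s, s ∈ K.faces ↔ s ∈ A.faces ∨ s ∈ B.faces)
    (hI : ∀ s, s ∈ I.faces ↔ s ∈ A.faces ∧ s ∈ B.faces) (hA : ExtConn A.space n)
    (hB : ExtConn B.space n) (hIn : ExtConn I.space (n - 1)) : ExtConn K.space n := by
  intro ι _ hι f fc fm
  obtain ⟨f', fc', hline, hloc⟩ := exists_truncation (isCompact_sphere 0 1) f fc fm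
  refine hasFilling_of_line f f' fc fc' hline ?_
  rw [space_inter hI] at hIn
  rw [space_union hK]
  refine HasFilling.union hA hB hIn hι f' fc' fun p hp => ?_
  obtain ⟨s, hs, h⟩ := hloc p hp
  exact ((hK s).1 hs).imp
    (fun hs => h.mono fun q hq => mem_space_iff.2 ⟨s, hs, hq⟩)
    (fun hs => h.mono fun q hq => mem_space_iff.2 ⟨s, hs, hq⟩)

/-- A complex is `n`-connected if every finite set of faces lies in an `n`-connected
subcomplex. -/
lemma extConn_of_finite {n : ℤ}
    (h : ∀ T : Finset (Finset V), (∀ s ∈ T, s ∈ K.faces) →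
      ∃ A : ASC V, A.faces ⊆ K.faces ∧ (∀ s ∈ T, s ∈ A.faces) ∧ ExtConn A.space n) :
    ExtConn K.space n := by
  classical
  intro ι _ hι f fc fm
  obtain ⟨f', fc', hline, hloc⟩ := exists_truncation (isCompact_sphere 0 1) f fc fm
  refine hasFilling_of_line f f' fc fc' hline ?_
  choose! s hs hsf using hloc
  obtain ⟨T, hTC, hT⟩ := (isCompact_sphere (0 : ι → ℝ) 1).elim_nhdsWithin_subcover _ hsf
  obtain ⟨A, hAK, hTA, hA⟩ := h (T.image s) (by
    intro t ht
    obtain ⟨p, hp, rfl⟩ := Finset.mem_image.1 ht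
    exact hs p (hTC p hp))
  obtain ⟨g, gc, gm, ge⟩ := hA ι hι f' fc' (by
    intro q hq
    obtain ⟨p, hp, hpq⟩ := mem_iUnion₂.1 (hT hq)
    exact mem_space_iff.2 ⟨s p, hTA _ (Finset.mem_image_of_mem s hp), hpq⟩)
  exact ⟨g, gc, gm.mono_right (space_mono hAK), ge⟩

/-- Cones are contractible. -/
lemma extConn_cone [DecidableEq V] (n : ℤ) (v : V) (hv : {v} ∈ K.faces)
    (h : ∀ s ∈ K.faces, insert v s ∈ K.faces) : ExtConn K.space n := by
  intro ι _ hι f fc fm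
  have he : ∀ s : Finset V, v ∈ s → Pi.single v 1 ∈ closedSimplex s := by
    intro s hs
    refine ⟨fun w => ?_, fun w hw => ?_, ?_⟩
    · by_cases h : w = v
      · subst h; simp
      · simp [h]
    · exact Pi.single_eq_of_ne (by rintro rfl; exact hw hs) _
    · simp [hs]
  refine hasFilling_of_line f (fun _ => Pi.single v 1) fc continuousOn_const (fun p hp => ?_) ?_
  · obtain ⟨s, hs, hps⟩ := mem_space_iff.1 (fm hp)
    exact ⟨_, h s hs, mem_closedSimplex_of_support hps
      fun w hw => hps.2.1 w fun h => hw (Finset.mem_insert_of_mem h), he _ (by simp)⟩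
  · exact ⟨fun _ => Pi.single v 1, continuousOn_const,
      fun _ _ => mem_space_iff.2 ⟨_, hv, he _ (by simp)⟩, fun _ _ => rfl⟩

variable [DecidableEq V]

/-- The subcomplex of the join of the full simplex on `σ` with `G` whose faces satisfy the
hereditary condition `P`. -/
def relJoin (G : ASC V) (σ : Finset V) (P : Finset V → Prop) (hP : ∀ s t, t ⊆ s → P s → P t) :
    ASC V where
  faces := {s | s.Nonempty ∧ P s ∧ (s \ σ = ∅ ∨ s \ σ ∈ G.faces)}
  nonempty_of_mem := fun _ h => h.1
  down_closed := by
    rintro s t ⟨-, hs, h⟩ hts ht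
    refine ⟨ht, hP s t hts hs, ?_⟩
    have hsub : t \ σ ⊆ s \ σ := Finset.sdiff_subset_sdiff hts le_rfl
    rcases Finset.eq_empty_or_nonempty (t \ σ) with h0 | h0
    · exact Or.inl h0
    · refine Or.inr (G.down_closed (h.resolve_left fun h1 => ?_) hsub h0)
      rw [h1, Finset.subset_empty] at hsub
      exact h0.ne_empty hsub

/-- The join of the boundary of the simplex `σ` with `G`. -/
def boundaryJoin (G : ASC V) (σ : Finset V) : ASC V :=
  G.relJoin σ (fun s => ¬ σ ⊆ s) fun _ _ hts hs h => hs (h.trans hts)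

/-- Connectivity of the join of a complex with the boundary of a simplex. -/
lemma extConn_boundaryJoin (G : ASC V) {σ : Finset V} (hσ : σ.Nonempty) :
    ∀ n : ℤ, (∀ t ∈ G.faces, Disjoint σ t) → ExtConn G.space (n - σ.card) →
      ExtConn (G.boundaryJoin σ).space (n - 1) := by
  induction hσ using Finset.Nonempty.cons_induction with
  | singleton v =>
    intro n hdisj hG
    rw [Finset.card_singleton, Nat.cast_one] at hG
    convert hG using 1
    refine Subset.antisymm (space_mono ?_) (space_mono ?_)
    · rintro s ⟨hne, hs, h⟩
      rw [Finset.singleton_subset_iff] at hs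
      rw [Finset.sdiff_singleton_eq_erase, Finset.erase_eq_of_notMem hs] at h
      exact h.resolve_left hne.ne_empty
    · intro s hs
      have hv : v ∉ s := Finset.disjoint_singleton_left.1 (hdisj s hs)
      refine ⟨G.nonempty_of_mem hs, by simpa using hv, ?_⟩
      rw [Finset.sdiff_singleton_eq_erase, Finset.erase_eq_of_notMem hv]
      exact Or.inr hs
  | cons v ρ hv hρ ih =>
    intro n hdisj hG
    rw [Finset.card_cons] at hG
    have hvt : ∀ t ∈ G.faces, v ∉ t := fun t ht =>
      Finset.disjoint_left.1 (hdisj t ht) (Finset.mem_cons_self v ρ)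
    have hI := ih (n - 1) (fun t ht => (hdisj t ht).mono_left (Finset.subset_cons hv))
      (by convert hG using 1; push_cast; ring)
    obtain ⟨w, hw⟩ := hρ
    have hwv : w ≠ v := by rintro rfl; exact hv hw
    refine extConn_union (A := G.relJoin (Finset.cons v ρ hv) (fun s => v ∉ s)
      fun s t hts hs h => hs (hts h)) (B := G.relJoin (Finset.cons v ρ hv) (fun s => ¬ ρ ⊆ s)
      fun s t hts hs h => hs (h.trans hts)) (I := G.boundaryJoin ρ) ?_ ?_ ?_ ?_ hI
    · intro s
      simp only [boundaryJoin, relJoin, mem_ofPred_eq, Finset.cons_subset]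
      tauto
    · intro s
      simp only [boundaryJoin, relJoin, mem_ofPred_eq]
      have hsd : v ∉ s → s \ Finset.cons v ρ hv = s \ ρ := by
        intro hvs
        ext a
        simp only [Finset.mem_sdiff, Finset.mem_cons]
        constructor
        · tauto
        · rintro ⟨h1, h2⟩
          exact ⟨h1, by rintro (rfl | h3); exacts [hvs h1, h2 h3]⟩
      constructor
      · rintro ⟨hne, hρs, h⟩
        have hvs : v ∉ s := by
          intro hvs
          have : v ∈ s \ ρ := Finset.mem_sdiff.2 ⟨hvs, hv⟩
          rcases h with h | h
          · simp [h] at this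
          · exact hvt _ h this
        rw [hsd hvs]
        exact ⟨⟨hne, hvs, h⟩, hne, hρs, h⟩
      · rintro ⟨⟨hne, hvs, h⟩, -, hρs, -⟩
        rw [hsd hvs] at h
        exact ⟨hne, hρs, h⟩
    · refine extConn_cone _ w ⟨Finset.singleton_nonempty w, by simpa using hwv.symm, ?_⟩ ?_
      · left; simp [hw]
      · rintro s ⟨-, hvs, h⟩
        refine ⟨Finset.insert_nonempty _ _, by simp [hwv.symm, hvs], ?_⟩
        rwa [Finset.insert_sdiff_of_mem _ (Finset.mem_cons_of_mem hw)]
    · refine extConn_cone _ v ⟨Finset.singleton_nonempty v, ?_, ?_⟩ ?_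
      · intro h
        exact hwv (Finset.mem_singleton.1 (h hw))
      · left; simp
      · rintro s ⟨-, hρs, h⟩
        refine ⟨Finset.insert_nonempty _ _, ?_, ?_⟩
        · change ¬ ρ ⊆ insert v s
          rwa [Finset.subset_insert_iff_of_notMem hv]
        · rwa [Finset.insert_sdiff_of_mem _ (Finset.mem_cons_self v ρ)]

/-- The subcomplex of the simplices all of whose bad faces belong to `S`. -/
def badIn (K : ASC V) (Bad : Set (Finset V)) (S : Finset (Finset V)) : ASC V where
  faces := {s | s ∈ K.faces ∧ ∀ u, u ⊆ s → u ∈ Bad → u ∈ S}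
  nonempty_of_mem := fun _ h => K.nonempty_of_mem h.1
  down_closed := fun _ _ ⟨hs, h⟩ hts ht =>
    ⟨K.down_closed hs hts ht, fun u hu => h u (hu.trans hts)⟩

/-- The closed star of `σ` in `K.badIn Bad S`, for a simplex `σ` of that complex. -/
def badStar (K : ASC V) (Bad : Set (Finset V)) (S : Finset (Finset V)) (σ : Finset V) : ASC V where
  faces := {s | s.Nonempty ∧ s ∪ σ ∈ (K.badIn Bad S).faces}
  nonempty_of_mem := fun _ h => h.1
  down_closed := fun _ _ ⟨_, h⟩ hts ht =>
    ⟨ht, (K.badIn Bad S).down_closed h (Finset.union_subset_union_left hts)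
      (ht.mono Finset.subset_union_left)⟩

lemma extConn_badIn {L : ASC V} (hLK : L.faces ⊆ K.faces) {Bad : Set (Finset V)}
    (hBad : ∀ s ∈ Bad, s ∈ K.faces ∧ s ∉ L.faces)
    (h1 : ∀ s ∈ K.faces, (∀ t, t ⊆ s → t.Nonempty → t ∉ Bad) → s ∈ L.faces)
    (h2 : ∀ s ∈ K.faces, ∀ t u, t ⊆ s → u ⊆ s → t ∈ Bad → u ∈ Bad → t ∪ u ∈ Bad)
    {n : ℤ} (hL : ExtConn L.space n)
    (hG : ∀ σ ∈ Bad, ExtConn (goodFor K Bad σ).space (n - σ.card)) (S : Finset (Finset V)) :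
    (∀ σ ∈ S, σ ∈ Bad) → (∀ σ ∈ S, ∀ u ∈ Bad, u ⊆ σ → u ∈ S) →
      ExtConn (K.badIn Bad S).space n := by
  induction S using Finset.induction_on_max_value (fun s : Finset V => s.card) with
  | empty =>
    intro _ _
    convert hL using 1
    refine Subset.antisymm (space_mono ?_) (space_mono ?_)
    · rintro s ⟨hs, h⟩
      exact h1 s hs fun t hts _ ht => by simpa using h t hts ht
    · intro s hs
      exact ⟨hLK hs, fun u hu hb => absurd
        (L.down_closed hs hu (K.nonempty_of_mem (hBad u hb).1)) (hBad u hb).2⟩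
  | insert σ T hσT hmax ih =>
    intro hS hdown
    have hσ : σ ∈ Bad := hS σ (Finset.mem_insert_self _ _)
    have hσK := (hBad σ hσ).1
    have hσne := K.nonempty_of_mem hσK
    have hσdown := hdown σ (Finset.mem_insert_self _ _)
    have hTn := ih (fun ρ hρ => hS ρ (Finset.mem_insert_of_mem hρ)) fun ρ hρ u hu huρ => by
      refine (Finset.mem_insert.1 (hdown ρ (Finset.mem_insert_of_mem hρ) u hu huρ)).resolve_left ?_
      rintro rfl
      exact hσT (Finset.eq_of_subset_of_card_le huρ (hmax ρ hρ) ▸ hρ)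
    have hσS : σ ∈ (K.badIn Bad (insert σ T)).faces := ⟨hσK, fun u hu hb => hσdown u hb hu⟩
    refine extConn_union (A := K.badIn Bad T) (B := K.badStar Bad (insert σ T) σ)
      (I := (goodFor K Bad σ).boundaryJoin σ) ?_ ?_ hTn ?_
      (extConn_boundaryJoin _ hσne n (fun t ht => ht.1.2.1) (hG σ hσ))
    · intro s
      constructor
      · rintro ⟨hs, h⟩
        by_cases hσs : σ ⊆ s
        · right
          refine ⟨K.nonempty_of_mem hs, ?_⟩
          rw [Finset.union_eq_left.2 hσs]
          exact ⟨hs, h⟩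
        · refine Or.inl ⟨hs, fun u hu hb => (Finset.mem_insert.1 (h u hu hb)).resolve_left ?_⟩
          rintro rfl
          exact hσs hu
      · rintro (⟨hs, h⟩ | ⟨hne, hs⟩)
        · exact ⟨hs, fun u hu hb => Finset.mem_insert_of_mem (h u hu hb)⟩
        · exact (K.badIn Bad (insert σ T)).down_closed hs Finset.subset_union_left hne
    · intro s
      constructor
      · rintro ⟨hne, hσs, hsd⟩
        have hsdu : s \ σ ∪ σ = s ∪ σ := Finset.sdiff_union_self_eq_union
        have hgood : s ∪ σ ∈ K.faces ∧ ∀ u, u ⊆ s ∪ σ → u ∈ Bad → u ⊆ σ := by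
          rcases hsd with h | h
          · rw [Finset.union_eq_right.2 (Finset.sdiff_eq_empty_iff_subset.1 h)]
            exact ⟨hσK, fun u hu _ => hu⟩
          · refine ⟨?_, fun u hu hb => h.2 u (by rwa [hsdu]) (K.nonempty_of_mem (hBad u hb).1) hb⟩
            have := h.1.2.2
            rwa [Finset.union_comm, hsdu] at this
        refine ⟨⟨K.down_closed hgood.1 Finset.subset_union_left hne, fun u hu hb => ?_⟩, hne,
          hgood.1, fun u hu hb => hσdown u hb (hgood.2 u hu hb)⟩
        have huσ := hgood.2 u (hu.trans Finset.subset_union_left) hb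
        refine (Finset.mem_insert.1 (hσdown u hb huσ)).resolve_left ?_
        rintro rfl
        exact hσs hu
      · rintro ⟨⟨hs, hsT⟩, hne, hsK, hsS⟩
        refine ⟨hne, fun h => hσT (hsT σ h hσ), ?_⟩
        rcases Finset.eq_empty_or_nonempty (s \ σ) with h0 | h0
        · exact Or.inl h0
        · refine Or.inr ⟨⟨K.down_closed hs Finset.sdiff_subset h0, Finset.disjoint_sdiff, ?_⟩, ?_⟩
          · rwa [Finset.union_sdiff_self_eq_union, Finset.union_comm]
          · intro u hu _ hb
            rw [Finset.sdiff_union_self_eq_union] at hu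
            have hub := h2 _ hsK u σ hu Finset.subset_union_right hb hσ
            have hmem := hsS _ (Finset.union_subset hu Finset.subset_union_right) hub
            have hcard : (u ∪ σ).card ≤ σ.card := by
              rcases Finset.mem_insert.1 hmem with h | h
              · rw [h]
              · exact hmax _ h
            exact Finset.union_eq_right.1
              (Finset.eq_of_subset_of_card_le Finset.subset_union_right hcard).symm
    · obtain ⟨v, hv⟩ := hσne
      refine extConn_cone n v ⟨Finset.singleton_nonempty v, ?_⟩ ?_
      · rwa [Finset.union_eq_right.2 (by simpa using hv)]
      · rintro s ⟨-, hs⟩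
        refine ⟨Finset.insert_nonempty _ _, ?_⟩
        rwa [Finset.insert_union, Finset.insert_eq_of_mem (Finset.mem_union_right _ hv)]

end ASC

end Realization

/-- Link argument, version (b): if `Y` is `n`-connected and `G_σ` is `(n − dim σ − 1)`-connected
for every bad simplex `σ`, then `X` is `n`-connected. -/
theorem link_argument_up {V : Type} [DecidableEq V] (K L : ASC V) (hLK : L.faces ⊆ K.faces)
    (Bad : Set (Finset V)) (hBad : ∀ s ∈ Bad, s ∈ K.faces ∧ s ∉ L.faces)
    (h1 : ∀ s ∈ K.faces, (∀ t, t ⊆ s → t.Nonempty → t ∉ Bad) → s ∈ L.faces)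
    (h2 : ∀ s ∈ K.faces, ∀ t u, t ⊆ s → u ⊆ s → t ∈ Bad → u ∈ Bad → t ∪ u ∈ Bad)
    (n : ℤ) (hY : IsConn (↥L.space) n)
    (hG : ∀ σ ∈ Bad, IsConn (↥(goodFor K Bad σ).space) (n - σ.card)) :
    IsConn (↥K.space) n := by
  classical
  refine ExtConn.isConn (ASC.extConn_of_finite fun T hT => ?_)
  let S := (T.sup id).powerset.filter (· ∈ Bad)
  refine ⟨K.badIn Bad S, fun s hs => hs.1, fun s hs => ⟨hT s hs, fun u hu hb => ?_⟩,
    ASC.extConn_badIn hLK hBad h1 h2 hY.extConn (fun σ hσ => (hG σ hσ).extConn) S ?_ ?_⟩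
  · exact Finset.mem_filter.2 ⟨Finset.mem_powerset.2 (hu.trans (Finset.le_sup (f := id) hs)), hb⟩
  · exact fun σ hσ => (Finset.mem_filter.1 hσ).2
  · intro σ hσ u hb huσ
    have hσ' := Finset.mem_powerset.1 (Finset.mem_filter.1 hσ).1
    exact Finset.mem_filter.2 ⟨Finset.mem_powerset.2 (huσ.trans hσ'), hb⟩
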